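/- For every n ≥ 0 and all integers a, b ≥ 0, the number of partitions π of [n] with cr(π) = a and ne(π) = b equals the number of partitions π of [n] with cr(π) = b and ne(π) = a. Equivalently, Σ_{π ∈ Π_n} p^{cr(π)} q^{ne(π)} = Σ_{π ∈ Π_n} p^{ne(π)} q^{cr(π)}. -/

import Mathlib

open Finset

/-- A set partition of `[n] = {1,…,n}`, modeled as a `Finpartition` of `Fin n`. -/
abbrev SetPartition (n : ℕ) := Finpartition (Finset.univ : Finset (Fin n))

/-- `(i,j)` is an arc of the partition `p`: `i < j`, they lie in a common block,
and no element of that block lies strictly between them. -/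
def IsArc {n : ℕ} (p : SetPartition n) (i j : Fin n) : Prop :=
  i < j ∧ ∃ B ∈ p.parts, i ∈ B ∧ j ∈ B ∧ ∀ x ∈ B, ¬ (i < x ∧ x < j)

/-- Arcs `a = (i₁,j₁)` and `b = (i₂,j₂)` form a crossing: `i₁ < i₂ < j₁ < j₂`. -/
def Crossing {n : ℕ} (a b : Fin n × Fin n) : Prop :=
  a.1 < b.1 ∧ b.1 < a.2 ∧ a.2 < b.2

/-- Arcs `a = (i₁,j₁)` and `b = (i₂,j₂)` form a nesting: `i₁ < i₂ < j₂ < j₁`. -/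
def Nesting {n : ℕ} (a b : Fin n × Fin n) : Prop :=
  a.1 < b.1 ∧ b.1 < b.2 ∧ b.2 < a.2

/-- `cr p`: the number of crossings of two arcs in `p`. -/
noncomputable def cr {n : ℕ} (p : SetPartition n) : ℕ :=
  {e : (Fin n × Fin n) × (Fin n × Fin n) |
    IsArc p e.1.1 e.1.2 ∧ IsArc p e.2.1 e.2.2 ∧ Crossing e.1 e.2}.ncard

/-- `ne' p`: the number of nestings of two arcs in `p`. -/
noncomputable def ne' {n : ℕ} (p : SetPartition n) : ℕ :=
  {e : (Fin n × Fin n) × (Fin n × Fin n) |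
    IsArc p e.1.1 e.1.2 ∧ IsArc p e.2.1 e.2.2 ∧ Nesting e.1 e.2}.ncard

/-- `al p`: the number of alignments (unordered pairs of arcs that neither
cross nor nest, counted with first endpoints in increasing order). -/
noncomputable def al {n : ℕ} (p : SetPartition n) : ℕ :=
  {e : (Fin n × Fin n) × (Fin n × Fin n) |
    IsArc p e.1.1 e.1.2 ∧ IsArc p e.2.1 e.2.2 ∧ e.1.1 < e.2.1 ∧
    ¬ Crossing e.1 e.2 ∧ ¬ Crossing e.2 e.1 ∧
    ¬ Nesting e.1 e.2 ∧ ¬ Nesting e.2 e.1}.ncard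

/-- `i` and `j` lie in a common block of `p`. -/
def InSameBlock {n : ℕ} (p : SetPartition n) (i j : Fin n) : Prop :=
  ∃ B ∈ p.parts, i ∈ B ∧ j ∈ B

/-- `c` (a partition of `[n+1]`) is a child of `p` (a partition of `[n]`):
deleting the element `1` from `c` and shifting down by one yields `p`. -/
def IsChild {n : ℕ} (c : SetPartition (n + 1)) (p : SetPartition n) : Prop :=
  ∀ i j : Fin n, (InSameBlock p i j ↔ InSameBlock c i.succ j.succ)

/-- `level p l` is `T(p, l)`: the set of partitions of `[n+l]` at the `l`-th level of
the subtree rooted at `p` in the tree of partitions. -/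
def level {n : ℕ} (p : SetPartition n) : (l : ℕ) → Set (SetPartition (n + l))
  | 0 => {p}
  | l + 1 => {c | ∃ q ∈ level p l, IsChild c q}

/-- The statistic `s_{α,β}(p) = cr(p)·α + ne(p)·β`. -/
noncomputable def statS {G : Type*} [AddCommGroup G] (α β : G) {n : ℕ} (p : SetPartition n) : G :=
  cr p • α + ne' p • β

section ArcSets

variable {n : ℕ}

open Classical in
/-- The number of crossings of a set of arcs. -/
noncomputable def arcCr (A : Finset (Fin n × Fin n)) : ℕ :=
  #{e ∈ A ×ˢ A | Crossing e.1 e.2}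

open Classical in
/-- The number of nestings of a set of arcs. -/
noncomputable def arcNe (A : Finset (Fin n × Fin n)) : ℕ :=
  #{e ∈ A ×ˢ A | Nesting e.1 e.2}

/-- `A` is a set of increasing arcs, no two with the same left or right endpoint, whose right
endpoints lie in `C`, whose left endpoints lie in `O ∪ C`, and which uses every vertex of `O` as a
left endpoint. -/
structure IsCompletion (O C : Finset (Fin n)) (A : Finset (Fin n × Fin n)) : Prop where
  lt : ∀ e ∈ A, e.1 < e.2
  right_mem : ∀ e ∈ A, e.2 ∈ C
  left_mem : ∀ e ∈ A, e.1 ∈ O ∨ e.1 ∈ C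
  left_inj : ∀ e ∈ A, ∀ f ∈ A, e.1 = f.1 → e = f
  right_inj : ∀ e ∈ A, ∀ f ∈ A, e.2 = f.2 → e = f
  exists_left : ∀ o ∈ O, ∃ e ∈ A, e.1 = o

open Classical in
/-- The finite set of all arc sets completing the open vertices `O` by means of `C`. -/
noncomputable def completions (O C : Finset (Fin n)) : Finset (Finset (Fin n × Fin n)) :=
  {A | IsCompletion O C A}

lemma mem_completions {O C : Finset (Fin n)} {A : Finset (Fin n × Fin n)} :
    A ∈ completions O C ↔ IsCompletion O C A := by
  simp [completions]

lemma completions_empty_right (O : Finset (Fin n)) :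
    completions O ∅ = if O = ∅ then {∅} else ∅ := by
  ext A
  rw [mem_completions]
  split_ifs with h
  · subst h
    rw [mem_singleton]
    constructor
    · intro hA
      exact eq_empty_of_forall_notMem fun e he => by simpa using hA.right_mem e he
    · rintro rfl
      constructor <;> simp
  · simp only [notMem_empty, iff_false]
    intro hA
    obtain ⟨o, ho⟩ := nonempty_iff_ne_empty.mpr h
    obtain ⟨e, he, -⟩ := hA.exists_left o ho
    simpa using hA.right_mem e he

/-- A completion in which the first vertex `a` is not a right endpoint either avoids `a` or opens an
arc at `a`. -/
lemma isCompletion_insert_of_forall_ne {O C : Finset (Fin n)} {a : Fin n}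
    (hC : ∀ c ∈ C, a < c) {A : Finset (Fin n × Fin n)} :
    (IsCompletion O (insert a C) A ∧ ∀ e ∈ A, e.2 ≠ a) ↔
      IsCompletion O C A ∨ IsCompletion (insert a O) C A := by
  constructor
  · rintro ⟨h, ha⟩
    by_cases hl : ∃ e ∈ A, e.1 = a
    · right
      refine ⟨h.lt, fun e he => ?_, fun e he => ?_, h.left_inj, h.right_inj, fun o ho => ?_⟩
      · have := h.right_mem e he; have := ha e he; grind
      · have := h.left_mem e he; grind
      · have := h.exists_left o; grind
    · left
      refine ⟨h.lt, fun e he => ?_, fun e he => ?_, h.left_inj, h.right_inj, h.exists_left⟩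
      · have := h.right_mem e he; have := ha e he; grind
      · have := h.left_mem e he; grind
  · rintro (h | h)
    · refine ⟨⟨h.lt, fun e he => ?_, fun e he => ?_, h.left_inj, h.right_inj, h.exists_left⟩,
        fun e he => ?_⟩
      · exact mem_insert_of_mem (h.right_mem e he)
      · have := h.left_mem e he; grind
      · exact (hC _ (h.right_mem e he)).ne.symm
    · refine ⟨⟨h.lt, fun e he => ?_, fun e he => ?_, h.left_inj, h.right_inj,
        fun o ho => h.exists_left o (mem_insert_of_mem ho)⟩, fun e he => ?_⟩
      · exact mem_insert_of_mem (h.right_mem e he)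
      · have := h.left_mem e he; grind
      · exact (hC _ (h.right_mem e he)).ne.symm

/-- Adding the arc `(i, a)` to a completion in which `a` is not a right endpoint. -/
lemma isCompletion_insert_arc {O C : Finset (Fin n)} {a i : Fin n} (hO : ∀ o ∈ O, o < a)
    (hC : ∀ c ∈ C, a < c) (hi : i ∈ O) {A : Finset (Fin n × Fin n)}
    (h : IsCompletion (O.erase i) (insert a C) A) (ha : ∀ e ∈ A, e.2 ≠ a) :
    IsCompletion O (insert a C) (insert (i, a) A) := by
  have hia : ∀ e ∈ A, e.1 ≠ i := by
    intro e he
    have := h.left_mem e he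
    have := hO i hi
    grind
  refine ⟨?_, ?_, ?_, ?_, ?_, ?_⟩
  · have := h.lt; have := hO i hi; grind
  · have := h.right_mem; grind
  · have := h.left_mem; grind
  · have := h.left_inj; grind
  · have := h.right_inj; grind
  · intro o ho
    rcases eq_or_ne o i with rfl | hoi
    · exact ⟨_, mem_insert_self _ _, rfl⟩
    · obtain ⟨e, he, rfl⟩ := h.exists_left o (mem_erase.mpr ⟨hoi, ho⟩)
      exact ⟨e, mem_insert_of_mem he, rfl⟩

/-- Removing the arc ending at the first vertex `a`. -/
lemma IsCompletion.erase_arc {O C : Finset (Fin n)} {a i : Fin n}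
    (hC : ∀ c ∈ C, a < c) {A : Finset (Fin n × Fin n)}
    (h : IsCompletion O (insert a C) A) (ha : (i, a) ∈ A) :
    i ∈ O ∧ IsCompletion (O.erase i) (insert a C) (A.erase (i, a)) ∧
      ∀ e ∈ A.erase (i, a), e.2 ≠ a := by
  have hlt := h.lt _ ha
  have hi : i ∈ O := by
    have := h.left_mem _ ha
    grind
  refine ⟨hi, ⟨?_, ?_, ?_, ?_, ?_, ?_⟩, ?_⟩
  · have := h.lt; grind
  · have := h.right_mem; grind
  · have := h.left_mem; have := h.left_inj; grind
  · have := h.left_inj; grind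
  · have := h.right_inj; grind
  · intro o ho
    obtain ⟨hoi, ho⟩ := mem_erase.mp ho
    obtain ⟨e, he, rfl⟩ := h.exists_left o ho
    exact ⟨e, mem_erase.mpr ⟨fun h => hoi (congrArg Prod.fst h), he⟩, rfl⟩
  · have := h.right_inj; grind

open Classical in
/-- Splitting a sum over completions according to the role of the first vertex `a`. -/
lemma sum_completions_insert {O C : Finset (Fin n)} {a : Fin n}
    (hO : ∀ o ∈ O, o < a) (hC : ∀ c ∈ C, a < c) (ψ : Finset (Fin n × Fin n) → ℕ) :
    ∑ A ∈ completions O (insert a C), ψ A =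
      (∑ A ∈ completions O C, ψ A + ∑ A ∈ completions (insert a O) C, ψ A) +
      ∑ i ∈ O, (∑ A ∈ completions (O.erase i) C, ψ (insert (i, a) A) +
        ∑ A ∈ completions (insert a (O.erase i)) C, ψ (insert (i, a) A)) := by
  have hsplit : ∀ (O' : Finset (Fin n)), (∀ o ∈ O', o < a) →
      ∀ χ : Finset (Fin n × Fin n) → ℕ,
      ∑ A ∈ completions O' C, χ A + ∑ A ∈ completions (insert a O') C, χ A =
        ∑ A ∈ completions O' (insert a C) with ∀ e ∈ A, e.2 ≠ a, χ A := by
    intro O' hO' χ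
    rw [← sum_union]
    · refine sum_congr ?_ fun _ _ => rfl
      ext A
      simp only [mem_union, mem_filter, mem_completions]
      exact (isCompletion_insert_of_forall_ne hC).symm
    · rw [disjoint_left]
      intro A h1 h2
      rw [mem_completions] at h1 h2
      obtain ⟨e, he, hea⟩ := h2.exists_left a (mem_insert_self _ _)
      rcases h1.left_mem e he with h | h
      · exact (hO' _ h).ne hea
      · exact (hC _ h).ne' hea
  rw [hsplit O hO, ← sum_filter_add_sum_filter_not _ (fun A => ∀ e ∈ A, e.2 ≠ a)]
  congr 1
  rw [sum_congr rfl fun i _ => hsplit (O.erase i) (fun o ho => hO o (mem_of_mem_erase ho))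
    (fun A => ψ (insert (i, a) A)), sum_sigma']
  symm
  refine sum_bij (fun x _ => insert (x.1, a) x.2) ?_ ?_ ?_ ?_
  · rintro ⟨i, A⟩ h
    simp only [mem_sigma, mem_filter, mem_completions] at h ⊢
    exact ⟨isCompletion_insert_arc hO hC h.1 h.2.1 h.2.2, by simp⟩
  · rintro ⟨i, A⟩ h ⟨j, B⟩ h' hAB
    simp only [mem_sigma, mem_filter, mem_completions] at h h' hAB
    have hA : (i, a) ∉ A := fun hm => h.2.2 _ hm rfl
    have hB : (j, a) ∉ B := fun hm => h'.2.2 _ hm rfl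
    have hij : i = j := by
      have : (i, a) ∈ insert (j, a) B := hAB ▸ mem_insert_self _ _
      rcases mem_insert.mp this with h1 | h1
      · exact congrArg Prod.fst h1
      · exact absurd rfl (h'.2.2 _ h1)
    subst hij
    have : A = B := by rw [← erase_insert hA, hAB, erase_insert hB]
    rw [this]
  · intro A h
    simp only [mem_filter, mem_completions] at h
    obtain ⟨h, h'⟩ := h
    push Not at h'
    obtain ⟨⟨i, b⟩, he, rfl⟩ := h'
    obtain ⟨hi, h1, h2⟩ := h.erase_arc hC he
    refine ⟨⟨i, A.erase (i, b)⟩, ?_, insert_erase he⟩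
    simp only [mem_sigma, mem_filter, mem_completions]
    exact ⟨hi, h1, h2⟩
  · intros; rfl

open Classical in
/-- Adding `x` to `A` adds one related pair for each element of `A` related to `x`, on either side. -/
lemma card_filter_product_insert {α : Type*} [DecidableEq α] (R : α → α → Prop) {A : Finset α}
    {x : α}
    (hx : x ∉ A) (hxx : ¬ R x x) :
    #{e ∈ insert x A ×ˢ insert x A | R e.1 e.2} =
      #{e ∈ A ×ˢ A | R e.1 e.2} + #{e ∈ A | R x e} + #{e ∈ A | R e x} := by
  simp only [card_filter, sum_product, sum_insert hx, if_neg hxx, sum_add_distrib]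
  ring

section InsertArc

variable {O C : Finset (Fin n)} {a i : Fin n} {A : Finset (Fin n × Fin n)}

/-- Left endpoints identify the arcs of a completion with left endpoint in `O`. -/
lemma IsCompletion.card_filter_left (h : IsCompletion O C A) (P : Fin n → Prop) [DecidablePred P]
    [DecidablePred fun e : Fin n × Fin n => e.1 ∈ O ∧ P e.1] :
    #{e ∈ A | e.1 ∈ O ∧ P e.1} = #{o ∈ O | P o} := by
  refine card_bij (fun e _ => e.1) ?_ ?_ ?_
  · intro e he
    simp only [mem_filter] at he ⊢
    exact he.2
  · intro e he f hf hef
    exact h.left_inj e (mem_filter.mp he).1 f (mem_filter.mp hf).1 hef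
  · intro o ho
    obtain ⟨ho, hP⟩ := mem_filter.mp ho
    obtain ⟨e, he, rfl⟩ := h.exists_left o ho
    exact ⟨e, mem_filter.mpr ⟨he, ho, hP⟩, rfl⟩

lemma arcCr_insert (hO : ∀ o ∈ O, o < a) (hC : ∀ c ∈ C, a < c)
    (h : IsCompletion (O.erase i) (insert a C) A) (ha : ∀ e ∈ A, e.2 ≠ a) :
    arcCr (insert (i, a) A) = arcCr A + #{o ∈ O | i < o} := by
  classical
  have h1 : #{e ∈ A | Crossing (i, a) e} = #{o ∈ O | i < o} := by
    have : #{o ∈ O | i < o} = #{o ∈ O.erase i | i < o} := by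
      congr 1; ext o; simp only [mem_filter, mem_erase]; grind
    rw [this, ← h.card_filter_left]
    congr 1
    ext e
    simp only [mem_filter, Crossing]
    have := h.left_mem e
    have := h.right_mem e
    have := ha e
    have := hO e.1
    have := hC e.1
    have := hC e.2
    grind
  have h2 : #{e ∈ A | Crossing e (i, a)} = 0 := by
    rw [card_eq_zero, filter_eq_empty_iff]
    rintro e he ⟨-, -, h3⟩
    have := h.right_mem e he
    have := hC e.2
    have := ha e he
    grind
  have := card_filter_product_insert Crossing (A := A) (x := (i, a)) (fun hm => ha _ hm rfl)
    (fun h => h.1.false)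
  simpa only [arcCr, h1, h2, add_zero] using this

lemma arcNe_insert (hO : ∀ o ∈ O, o < a) (hC : ∀ c ∈ C, a < c) (hi : i ∈ O)
    (h : IsCompletion (O.erase i) (insert a C) A) (ha : ∀ e ∈ A, e.2 ≠ a) :
    arcNe (insert (i, a) A) = arcNe A + #{o ∈ O | o < i} := by
  classical
  have h1 : #{e ∈ A | Nesting e (i, a)} = #{o ∈ O | o < i} := by
    have : #{o ∈ O | o < i} = #{o ∈ O.erase i | o < i} := by
      congr 1; ext o; simp only [mem_filter, mem_erase]; grind
    rw [this, ← h.card_filter_left]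
    congr 1
    ext e
    simp only [mem_filter, Nesting]
    have := h.left_mem e
    have := h.right_mem e
    have := ha e
    have := hO i hi
    have := hC e.1
    have := hC e.2
    grind
  have h2 : #{e ∈ A | Nesting (i, a) e} = 0 := by
    rw [card_eq_zero, filter_eq_empty_iff]
    rintro e he ⟨-, -, h3⟩
    have := h.right_mem e he
    have := hC e.2
    have := ha e he
    grind
  have := card_filter_product_insert Nesting (A := A) (x := (i, a)) (fun hm => ha _ hm rfl)
    (fun h => h.1.false)
  simpa only [arcNe, h1, h2, add_zero] using this

end InsertArc

/-- Summing a function of the numbers of larger and smaller elements over a finite set. -/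
lemma sum_card_gt_card_lt {α : Type*} [LinearOrder α] (O : Finset α) (g : ℕ → ℕ → ℕ) :
    ∑ i ∈ O, g #{o ∈ O | i < o} #{o ∈ O | o < i} = ∑ r ∈ range #O, g (#O - 1 - r) r := by
  induction O using Finset.induction_on_max generalizing g with
  | empty => simp
  | insert a s hs ih =>
    have ha : a ∉ s := fun h => (hs a h).false
    rw [sum_insert ha, card_insert_of_notMem ha, sum_range_succ, add_comm]
    congr 1
    · have : ∀ i ∈ s, g #{o ∈ insert a s | i < o} #{o ∈ insert a s | o < i} =
          g (#{o ∈ s | i < o} + 1) #{o ∈ s | o < i} := by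
        intro i hi
        rw [filter_insert, if_pos (hs i hi), filter_insert, if_neg (hs i hi).not_gt,
          card_insert_of_notMem (by simp [ha])]
      rw [sum_congr rfl this, ih fun x y => g (x + 1) y]
      refine sum_congr rfl fun r hr => ?_
      have := mem_range.mp hr
      congr 1
      omega
    · rw [filter_insert, if_neg (lt_irrefl a), filter_insert, if_neg (lt_irrefl a),
        filter_true_of_mem hs, filter_false_of_mem fun x hx => (hs x hx).not_gt]
      simp

lemma sum_card_gt_card_lt_swap {α : Type*} [LinearOrder α] {O O' : Finset α} (h : #O = #O')
    (g : ℕ → ℕ → ℕ) :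
    ∑ i ∈ O, g #{o ∈ O | i < o} #{o ∈ O | o < i} =
      ∑ i ∈ O', g #{o ∈ O' | o < i} #{o ∈ O' | i < o} := by
  rw [sum_card_gt_card_lt, sum_card_gt_card_lt O' fun x y => g y x, h, ← sum_range_reflect]
  refine sum_congr rfl fun r hr => ?_
  have := mem_range.mp hr
  congr 1
  omega

/-- The joint distribution of crossings and nestings over completions depends only on the number
of open vertices and is symmetric. -/
lemma sum_completions_swap (C : Finset (Fin n)) {O O' : Finset (Fin n)}
    (hO : ∀ o ∈ O, ∀ c ∈ C, o < c) (hO' : ∀ o ∈ O', ∀ c ∈ C, o < c) (h : #O = #O')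
    (φ : ℕ → ℕ → ℕ) :
    ∑ A ∈ completions O C, φ (arcCr A) (arcNe A) =
      ∑ A ∈ completions O' C, φ (arcNe A) (arcCr A) := by
  induction C using Finset.induction_on_min generalizing O O' φ with
  | empty =>
    have : O = ∅ ↔ O' = ∅ := by rw [← card_eq_zero, h, card_eq_zero]
    simp only [completions_empty_right, this]
    split_ifs <;> simp [arcCr, arcNe]
  | insert a C hC ih =>
    have key : ∀ {O : Finset (Fin n)}, (∀ o ∈ O, ∀ c ∈ insert a C, o < c) → ∀ i ∈ O,
        ∀ A, (A ∈ completions (O.erase i) C ∨ A ∈ completions (insert a (O.erase i)) C) →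
        arcCr (insert (i, a) A) = arcCr A + #{o ∈ O | i < o} ∧
        arcNe (insert (i, a) A) = arcNe A + #{o ∈ O | o < i} := by
      intro O hO i hi A hA
      have hOa : ∀ o ∈ O, o < a := fun o ho => hO o ho a (mem_insert_self _ _)
      simp only [mem_completions] at hA
      obtain ⟨h1, h2⟩ := (isCompletion_insert_of_forall_ne hC).mpr hA
      exact ⟨arcCr_insert hOa hC h1 h2, arcNe_insert hOa hC hi h1 h2⟩
    have hOa : ∀ o ∈ O, o < a := fun o ho => hO o ho a (mem_insert_self _ _)
    have hOa' : ∀ o ∈ O', o < a := fun o ho => hO' o ho a (mem_insert_self _ _)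
    have ha : a ∉ O := fun h => (hOa a h).false
    have ha' : a ∉ O' := fun h => (hOa' a h).false
    rw [sum_completions_insert hOa hC, sum_completions_insert hOa' hC]
    congr 1
    · congr 1
      · exact ih (by grind) (by grind) h φ
      · refine ih (by grind) (by grind) ?_ φ
        rw [card_insert_of_notMem ha, card_insert_of_notMem ha', h]
    · rcases O.eq_empty_or_nonempty with rfl | ⟨i₀, hi₀⟩
      · have : O' = ∅ := by rw [← card_eq_zero, ← h, card_empty]
        simp [this]
      · let g : ℕ → ℕ → ℕ := fun x y =>
          ∑ A ∈ completions (O.erase i₀) C, φ (arcCr A + x) (arcNe A + y) +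
          ∑ A ∈ completions (insert a (O.erase i₀)) C, φ (arcCr A + x) (arcNe A + y)
        have hne : O'.Nonempty := by rw [← card_pos, ← h]; exact card_pos.mpr ⟨_, hi₀⟩
        have hL := sum_card_gt_card_lt_swap h g
        obtain ⟨j₀, hj₀⟩ := hne
        have hcard : ∀ i ∈ O, ∀ j ∈ O', #(O.erase i) = #(O'.erase j) := by
          intro i hi j hj
          rw [card_erase_of_mem hi, card_erase_of_mem hj, h]
        have hcard' : ∀ i ∈ O, ∀ j ∈ O', #(insert a (O.erase i)) = #(insert a (O'.erase j)) := by
          intro i hi j hj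
          rw [card_insert_of_notMem (by grind), card_insert_of_notMem (by grind), hcard i hi j hj]
        have hR : ∀ j ∈ O', ∀ x y, g x y =
            ∑ A ∈ completions (O'.erase j) C, φ (arcNe A + x) (arcCr A + y) +
            ∑ A ∈ completions (insert a (O'.erase j)) C, φ (arcNe A + x) (arcCr A + y) := by
          intro j hj x y
          refine congrArg₂ (· + ·) ?_ ?_
          · exact ih (by grind) (by grind) (hcard _ hi₀ _ hj) fun u v => φ (u + x) (v + y)
          · exact ih (by grind) (by grind) (hcard' _ hi₀ _ hj) fun u v => φ (u + x) (v + y)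
        have hR' : ∀ i ∈ O, ∀ x y, g x y =
            ∑ A ∈ completions (O.erase i) C, φ (arcCr A + x) (arcNe A + y) +
            ∑ A ∈ completions (insert a (O.erase i)) C, φ (arcCr A + x) (arcNe A + y) := by
          intro i hi x y
          rw [hR j₀ hj₀]
          symm
          refine congrArg₂ (· + ·) ?_ ?_
          · exact ih (by grind) (by grind) (hcard _ hi _ hj₀) fun u v => φ (u + x) (v + y)
          · exact ih (by grind) (by grind) (hcard' _ hi _ hj₀) fun u v => φ (u + x) (v + y)
        refine Eq.trans (sum_congr rfl fun i hi => ?_) (hL.trans (sum_congr rfl fun i hi => ?_))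
        · rw [hR' i hi]
          refine congrArg₂ (· + ·) (sum_congr rfl fun A hA => ?_) (sum_congr rfl fun A hA => ?_)
          · rw [(key hO i hi A (Or.inl hA)).1, (key hO i hi A (Or.inl hA)).2]
          · rw [(key hO i hi A (Or.inr hA)).1, (key hO i hi A (Or.inr hA)).2]
        · rw [hR i hi]
          refine congrArg₂ (· + ·) (sum_congr rfl fun A hA => ?_) (sum_congr rfl fun A hA => ?_)
          · rw [(key hO' i hi A (Or.inl hA)).1, (key hO' i hi A (Or.inl hA)).2]
          · rw [(key hO' i hi A (Or.inr hA)).1, (key hO' i hi A (Or.inr hA)).2]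

end ArcSets

section Arcs

variable {n : ℕ}

open Classical in
/-- The finite set of arcs of a partition. -/
noncomputable def arcs (p : SetPartition n) : Finset (Fin n × Fin n) :=
  {e | IsArc p e.1 e.2}

lemma mem_arcs {p : SetPartition n} {e : Fin n × Fin n} : e ∈ arcs p ↔ IsArc p e.1 e.2 := by
  simp [arcs]

lemma cr_eq_arcCr (p : SetPartition n) : cr p = arcCr (arcs p) := by
  classical
  rw [cr, arcCr, ← Set.ncard_coe_finset]
  congr 1
  ext e
  simp [mem_arcs, and_assoc]

lemma ne'_eq_arcNe (p : SetPartition n) : ne' p = arcNe (arcs p) := by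
  classical
  rw [ne', arcNe, ← Set.ncard_coe_finset]
  congr 1
  ext e
  simp [mem_arcs, and_assoc]

lemma IsArc.left_unique {p : SetPartition n} {i j k : Fin n} (h : IsArc p i k) (h' : IsArc p j k) :
    i = j := by
  obtain ⟨hi, B, hB, hiB, hkB, h⟩ := h
  obtain ⟨hj, B', hB', hjB, hkB', h'⟩ := h'
  obtain rfl := p.eq_of_mem_parts hB hB' hkB hkB'
  have := h j hjB
  have := h' i hiB
  grind

lemma IsArc.right_unique {p : SetPartition n} {i j k : Fin n} (h : IsArc p i j) (h' : IsArc p i k) :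
    j = k := by
  obtain ⟨hi, B, hB, hiB, hjB, h⟩ := h
  obtain ⟨hj, B', hB', hiB', hkB, h'⟩ := h'
  obtain rfl := p.eq_of_mem_parts hB hB' hiB hiB'
  have := h k hkB
  have := h' j hjB
  grind

lemma isCompletion_arcs (p : SetPartition n) : IsCompletion ∅ univ (arcs p) where
  lt _ he := (mem_arcs.mp he).1
  right_mem _ _ := mem_univ _
  left_mem _ _ := Or.inr (mem_univ _)
  left_inj := by
    rintro ⟨i, j⟩ he ⟨i', k⟩ hf (rfl : i = i')
    exact Prod.ext rfl ((mem_arcs.mp he).right_unique (mem_arcs.mp hf))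
  right_inj := by
    rintro ⟨i, j⟩ he ⟨k, j'⟩ hf (rfl : j = j')
    exact Prod.ext ((mem_arcs.mp he).left_unique (mem_arcs.mp hf)) rfl
  exists_left := by simp

lemma reflTransGen_isArc {p : SetPartition n} {B : Finset (Fin n)} (hB : B ∈ p.parts)
    {i j : Fin n} (hi : i ∈ B) (hj : j ∈ B) (hij : i ≤ j) :
    Relation.ReflTransGen (IsArc p) i j := by
  induction j using WellFoundedLT.induction with
  | ind j ih =>
    rcases hij.eq_or_lt with rfl | hlt
    · exact .refl
    · have hne : ({x ∈ B | x < j} : Finset (Fin n)).Nonempty := ⟨i, by simp [hi, hlt]⟩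
      have hm := max'_mem _ hne
      have hmax := fun x hx => le_max' ({x ∈ B | x < j} : Finset (Fin n)) x hx
      set m := max' _ hne
      simp only [mem_filter] at hm hmax
      refine (ih m hm.2 hm.1 (hmax i ⟨hi, hlt⟩)).tail ⟨hm.2, B, hB, hm.1, hj, fun x hx hx' => ?_⟩
      exact (hmax x ⟨hx, hx'.2⟩).not_gt hx'.1

lemma inSameBlock_of_reflTransGen {p : SetPartition n} {i j : Fin n}
    (h : Relation.ReflTransGen (IsArc p) i j) : InSameBlock p i j := by
  induction h with
  | refl =>
    obtain ⟨B, hB, hi⟩ := p.exists_mem (mem_univ i)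
    exact ⟨B, hB, hi, hi⟩
  | tail _ h ih =>
    obtain ⟨B, hB, hi, hj⟩ := ih
    obtain ⟨-, B', hB', hj', hk, -⟩ := h
    obtain rfl := p.eq_of_mem_parts hB hB' hj hj'
    exact ⟨B, hB, hi, hk⟩

lemma InSameBlock.symm {p : SetPartition n} {i j : Fin n} (h : InSameBlock p i j) :
    InSameBlock p j i := by
  obtain ⟨B, hB, hi, hj⟩ := h
  exact ⟨B, hB, hj, hi⟩

lemma inSameBlock_iff {p : SetPartition n} {i j : Fin n} :
    InSameBlock p i j ↔
      Relation.ReflTransGen (IsArc p) i j ∨ Relation.ReflTransGen (IsArc p) j i := by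
  constructor
  · rintro ⟨B, hB, hi, hj⟩
    exact (le_total i j).imp (reflTransGen_isArc hB hi hj) (reflTransGen_isArc hB hj hi)
  · rintro (h | h)
    · exact inSameBlock_of_reflTransGen h
    · exact (inSameBlock_of_reflTransGen h).symm

lemma setPartition_ext {p q : SetPartition n}
    (h : ∀ i j, InSameBlock p i j ↔ InSameBlock q i j) : p = q := by
  have key : ∀ {p q : SetPartition n}, (∀ i j, InSameBlock p i j ↔ InSameBlock q i j) →
      p.parts ⊆ q.parts := by
    intro p q h B hB
    obtain ⟨i, hi⟩ := p.nonempty_of_mem_parts hB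
    obtain ⟨B', hB', hi'⟩ := q.exists_mem (mem_univ i)
    suffices B = B' from this ▸ hB'
    ext j
    constructor
    · intro hj
      obtain ⟨D, hD, h1, h2⟩ := (h i j).mp ⟨B, hB, hi, hj⟩
      rwa [q.eq_of_mem_parts hB' hD hi' h1]
    · intro hj
      obtain ⟨D, hD, h1, h2⟩ := (h i j).mpr ⟨B', hB', hi', hj⟩
      rwa [p.eq_of_mem_parts hB hD hi h1]
  exact Finpartition.ext ((key h).antisymm (key fun i j => (h i j).symm))

lemma arcs_injective : Function.Injective (arcs : SetPartition n → _) := by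
  intro p q h
  have : IsArc p = IsArc q := by
    ext i j
    rw [← mem_arcs (e := (i, j)), h, mem_arcs]
  exact setPartition_ext fun i j => by rw [inSameBlock_iff, inSameBlock_iff, this]

lemma exists_arcs_eq {A : Finset (Fin n × Fin n)} (hA : IsCompletion ∅ univ A) :
    ∃ p, arcs p = A := by
  classical
  let r : Fin n → Fin n → Prop := fun i j => (i, j) ∈ A
  have hr : Relator.RightUnique r := fun i j k h h' =>
    congrArg Prod.snd (hA.left_inj _ h _ h' rfl)
  have hl : Relator.RightUnique (Function.swap r) := fun i j k h h' =>
    congrArg Prod.fst (hA.right_inj _ h _ h' rfl)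
  have hle : ∀ {i j}, Relation.ReflTransGen r i j → i ≤ j := by
    intro i j h
    induction h with
    | refl => rfl
    | tail _ h ih => exact ih.trans (hA.lt _ h).le
  have htrans : ∀ {i j k}, (Relation.ReflTransGen r i j ∨ Relation.ReflTransGen r j i) →
      (Relation.ReflTransGen r j k ∨ Relation.ReflTransGen r k j) →
      (Relation.ReflTransGen r i k ∨ Relation.ReflTransGen r k i) := by
    rintro i j k (h | h) (h' | h')
    · exact .inl (h.trans h')
    · have := Relation.ReflTransGen.total_of_right_unique hl h.swap h'.swap
      exact (this.imp (fun h => h.swap) fun h => h.swap).symm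
    · exact Relation.ReflTransGen.total_of_right_unique hr h h'
    · exact .inr (h'.trans h)
  let s : Setoid (Fin n) :=
    ⟨fun i j => Relation.ReflTransGen r i j ∨ Relation.ReflTransGen r j i,
      fun _ => .inl .refl, Or.symm, htrans⟩
  let p : SetPartition n := Finpartition.ofSetoid s
  have hsame : ∀ {i j}, InSameBlock p i j ↔
      (Relation.ReflTransGen r i j ∨ Relation.ReflTransGen r j i) := by
    intro i j
    have h1 : j ∈ p.part i ↔ s i j := Finpartition.mem_part_ofSetoid_iff_rel
    change _ ↔ s i j
    rw [← h1]
    constructor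
    · rintro ⟨B, hB, hi, hj⟩
      rwa [p.part_eq_of_mem hB hi]
    · exact fun h => ⟨p.part i, p.part_mem.mpr (mem_univ i), p.mem_part (mem_univ i), h⟩
  have hhead : ∀ {i j x}, r i j → i < x → Relation.ReflTransGen r i x → j ≤ x := by
    intro i j x hij hix h
    rcases h.cases_head with rfl | ⟨k, hk, hkx⟩
    · exact absurd hix (lt_irrefl _)
    · rw [hr hij hk]
      exact hle hkx
  refine ⟨p, ?_⟩
  ext ⟨i, j⟩
  rw [mem_arcs]
  constructor
  · rintro ⟨hij, B, hB, hi, hj, hbetween⟩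
    have hreach : Relation.ReflTransGen r i j := by
      rcases hsame.mp ⟨B, hB, hi, hj⟩ with h | h
      · exact h
      · exact absurd (hle h) hij.not_ge
    rcases hreach.cases_head with rfl | ⟨k, hk, hkj⟩
    · exact absurd hij (lt_irrefl _)
    · obtain ⟨B', hB', hi', hk'⟩ := hsame.mpr (.inl (.single hk))
      obtain rfl := p.eq_of_mem_parts hB hB' hi hi'
      rcases (hle hkj).eq_or_lt with rfl | hlt
      · exact hk
      · exact absurd ⟨hA.lt _ hk, hlt⟩ (hbetween k hk')
  · intro hij
    obtain ⟨B, hB, hi, hj⟩ := hsame.mpr (.inl (.single hij))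
    refine ⟨hA.lt _ hij, B, hB, hi, hj, fun x hx ⟨hix, hxj⟩ => ?_⟩
    rcases hsame.mp ⟨B, hB, hi, hx⟩ with h | h
    · exact (hhead hij hix h).not_gt hxj
    · exact (hle h).not_gt hix

/-- Counting partitions through their arc sets. -/
lemma ncard_setPartition_eq_sum (P : ℕ → ℕ → Prop) [∀ x y, Decidable (P x y)] :
    {p : SetPartition n | P (cr p) (ne' p)}.ncard =
      ∑ A ∈ completions (∅ : Finset (Fin n)) univ, if P (arcCr A) (arcNe A) then 1 else 0 := by
  classical
  rw [← card_filter, ← Set.ncard_image_of_injective _ arcs_injective, ← Set.ncard_coe_finset]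
  congr 1
  ext A
  simp only [Set.mem_image, Set.mem_ofPred_eq, coe_filter, mem_completions, cr_eq_arcCr,
    ne'_eq_arcNe]
  constructor
  · rintro ⟨p, hp, rfl⟩
    exact ⟨isCompletion_arcs p, hp⟩
  · rintro ⟨hA, hP⟩
    obtain ⟨p, rfl⟩ := exists_arcs_eq hA
    exact ⟨p, hP, rfl⟩

end Arcs

/-- Corollary 3.1, Kasraoui–Zeng. The joint distribution of crossings
and nestings over partitions of `[n]` is symmetric: for all `a, b`, the number of
partitions of `[n]` with `cr = a` and `ne = b` equals the number with `cr = b` and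
`ne = a`. -/
theorem statement7 (n a b : ℕ) :
    {p : SetPartition n | cr p = a ∧ ne' p = b}.ncard =
    {p : SetPartition n | cr p = b ∧ ne' p = a}.ncard := by
  rw [ncard_setPartition_eq_sum fun x y => x = a ∧ y = b,
    ncard_setPartition_eq_sum fun x y => x = b ∧ y = a,
    sum_completions_swap univ (by simp) (by simp) rfl
      fun x y => if x = a ∧ y = b then 1 else 0]
  simp only [and_comm]
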